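/- Let (X, d_X) be a metric space and consider the pair of compatible metric spaces with X₀ = X₁ = X and d₀ = d₁ = d_X. Given θ ∈ (0, 1) and q ∈ [1, ∞], the metric δ_{θ,q} is equivalent to d_X: for all x, y ∈ X, (1/M'_{θ,q})·d_X(x, y) ≤ δ_{θ,q}(x, y) ≤ d_X(x, y), where M'_{θ,q} := (Σ_{j∈ℤ} (2^{jθ}·min{1, 2^{-j}})^p)^{1/p} with 1/p + 1/q = 1 (with the obvious supremum modification if p = ∞). -/

import Mathlib

open scoped ENNReal Classical

/-- A function `d` is a metric on the subset `A` of `X`. -/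
structure IsMetricOn {X : Type*} (d : X → X → ℝ) (A : Set X) : Prop where
  refl : ∀ x ∈ A, d x x = 0
  eq_of_dist_eq_zero : ∀ x ∈ A, ∀ y ∈ A, d x y = 0 → x = y
  symm : ∀ x ∈ A, ∀ y ∈ A, d x y = d y x
  triangle : ∀ x ∈ A, ∀ y ∈ A, ∀ z ∈ A, d x z ≤ d x y + d y z

/-- A pair of compatible metric spaces `(X₀, X₁)_X` inside an ambient metric space `X`. -/
structure CompatiblePair (X : Type*) [MetricSpace X] where
  X0 : Set X
  X1 : Set X
  d0 : X → X → ℝ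
  d1 : X → X → ℝ
  inter_nonempty : (X0 ∩ X1).Nonempty
  met0 : IsMetricOn d0 X0
  met1 : IsMetricOn d1 X1
  C0 : ℝ
  C1 : ℝ
  C0_pos : 0 < C0
  C1_pos : 0 < C1
  compat0 : ∀ x ∈ X0, ∀ y ∈ X0, dist x y ≤ C0 * d0 x y
  compat1 : ∀ x ∈ X1, ∀ y ∈ X1, dist x y ≤ C1 * d1 x y

namespace CompatiblePair

variable {X : Type*} [MetricSpace X] (P : CompatiblePair X)

/-- The `J_M` functional: `J_M(t; x, y) = max {d₀(x,y), t·d₁(x,y)}`. -/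
noncomputable def JM (t : ℝ) (x y : X) : ℝ := max (P.d0 x y) (t * P.d1 x y)

/-- The cost function `h_t` on pairs in `X₀² ∪ X₁²`. -/
noncomputable def hFun (t : ℝ) (x y : X) : ℝ :=
  if x ∈ P.X0 ∩ P.X1 ∧ y ∈ P.X0 ∩ P.X1 then min (P.d0 x y) (t * P.d1 x y)
  else if x ∈ P.X0 ∧ y ∈ P.X0 then P.d0 x y
  else t * P.d1 x y

/-- `f 0 = x, …, f n = y` is an admissible linking sequence from `x` to `y` in `X₀ ∪ X₁`. -/
def IsAdmissibleChain (x y : X) (n : ℕ) (f : ℕ → X) : Prop :=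
  f 0 = x ∧ f n = y ∧ (∀ k ≤ n, f k ∈ P.X0 ∪ P.X1) ∧
    ∀ k < n, (f k ∈ P.X0 ∧ f (k + 1) ∈ P.X0) ∨ (f k ∈ P.X1 ∧ f (k + 1) ∈ P.X1)

/-- The `K_M` functional: infimum of `∑ h_t` over admissible linking sequences. -/
noncomputable def KM (t : ℝ) (x y : X) : ℝ :=
  sInf { s : ℝ | ∃ n f, P.IsAdmissibleChain x y n f ∧
    s = ∑ k ∈ Finset.range n, P.hFun t (f k) (f (k + 1)) }

end CompatiblePair

/-- The functional `Γ_{θ,q}` of a bi-infinite real sequence, valued in `[0,∞]`. -/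
noncomputable def GammaE (θ : ℝ) (q : ℝ≥0∞) (x : ℤ → ℝ) : ℝ≥0∞ :=
  if q = ∞ then ⨆ k : ℤ, ENNReal.ofReal ((2 : ℝ) ^ (-(k : ℝ) * θ) * |x k|)
  else (∑' k : ℤ, ENNReal.ofReal ((2 : ℝ) ^ (-(k : ℝ) * θ) * |x k|) ^ q.toReal) ^ (1 / q.toReal)

/-- The real-valued functional `Γ_{θ,q}`. -/
noncomputable def Gamma (θ : ℝ) (q : ℝ≥0∞) (x : ℤ → ℝ) : ℝ := (GammaE θ q x).toReal

/-- The constant `M_{θ,q} = Γ_{θ,q}((min{1, 2^k})_k)`. -/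
noncomputable def MThetaQ (θ : ℝ) (q : ℝ≥0∞) : ℝ :=
  Gamma θ q (fun k : ℤ => min 1 ((2 : ℝ) ^ k))

/-- The constant `M'_{θ,q} = (∑_j (2^{jθ} min{1,2^{-j}})^p)^{1/p}` (with `p` the
conjugate exponent of `q`, and the supremum modification for `p = ∞`). -/
noncomputable def MConst' (θ : ℝ) (p : ℝ≥0∞) : ℝ :=
  (if p = ∞ then ⨆ j : ℤ, ENNReal.ofReal ((2 : ℝ) ^ ((j : ℝ) * θ) * min 1 ((2 : ℝ) ^ (-(j : ℝ))))
   else (∑' j : ℤ,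
      ENNReal.ofReal ((2 : ℝ) ^ ((j : ℝ) * θ) * min 1 ((2 : ℝ) ^ (-(j : ℝ)))) ^ p.toReal) ^
        (1 / p.toReal)).toReal

/-- The `ℓ^q` norm of a bi-infinite real sequence, valued in `[0,∞]`. -/
noncomputable def lqNorm (q : ℝ≥0∞) (c : ℤ → ℝ) : ℝ≥0∞ :=
  if q = ∞ then ⨆ k : ℤ, ENNReal.ofReal |c k|
  else (∑' k : ℤ, ENNReal.ofReal |c k| ^ q.toReal) ^ (1 / q.toReal)

namespace CompatiblePair

variable {X : Type*} [MetricSpace X] (P : CompatiblePair X)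

/-- The metric `β_{θ,q}(x,y) = Γ_{θ,q}((K_M(2^k; x, y))_k)` on `X₀ ∩ X₁`. -/
noncomputable def beta (θ : ℝ) (q : ℝ≥0∞) (x y : X) : ℝ :=
  Gamma θ q (fun k : ℤ => P.KM ((2 : ℝ) ^ k) x y)

/-- `u` is an approximating sequence of `x` in `(X₀ ∩ X₁, J_M(1))`: a sequence in
`X₀ ∩ X₁`, Cauchy for `J_M(1)`, with `K_M(1; uₙ, x) → 0`. -/
def IsApproxSeq (x : X) (u : ℕ → X) : Prop :=
  (∀ n, u n ∈ P.X0 ∩ P.X1) ∧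
  (∀ ε > 0, ∃ N, ∀ m ≥ N, ∀ n ≥ N, P.JM 1 (u m) (u n) < ε) ∧
  Filter.Tendsto (fun n => P.KM 1 (u n) x) Filter.atTop (nhds 0)

/-- The bi-infinite linking sequence `S_k = u_k` for `k ≥ 0`, `S_k = v_{-k}` for `k < 0`. -/
noncomputable def linkSeq (u v : ℕ → X) : ℤ → X :=
  fun k => if 0 ≤ k then u k.toNat else v (-k).toNat

/-- The functional `p_{θ,q}` valued in `[0,∞]`: infimum of
`Γ_{θ,q}((J_M(2^k; S_k, S_{k+1}))_k)` over approximating sequences of `x` and `y`. -/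
noncomputable def pFunE (θ : ℝ) (q : ℝ≥0∞) (x y : X) : ℝ≥0∞ :=
  ⨅ (u : ℕ → X) (v : ℕ → X) (_ : P.IsApproxSeq x u) (_ : P.IsApproxSeq y v),
    GammaE θ q (fun k : ℤ =>
      P.JM ((2 : ℝ) ^ k) (linkSeq u v k) (linkSeq u v (k + 1)))

/-- The real-valued functional `p_{θ,q}`. -/
noncomputable def pFun (θ : ℝ) (q : ℝ≥0∞) (x y : X) : ℝ := (P.pFunE θ q x y).toReal

/-- The symmetrization `P_{θ,q}(x,y) = (p_{θ,q}(x,y) + p_{θ,q}(y,x))/2`. -/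
noncomputable def PFun (θ : ℝ) (q : ℝ≥0∞) (x y : X) : ℝ :=
  (P.pFun θ q x y + P.pFun θ q y x) / 2

/-- The metric `δ_{θ,q}`: infimum of `∑ P_{θ,q}` over finite chains in `X₀ ∩ X₁`. -/
noncomputable def delta (θ : ℝ) (q : ℝ≥0∞) (x y : X) : ℝ :=
  sInf { s : ℝ | ∃ (n : ℕ) (f : ℕ → X), f 0 = x ∧ f n = y ∧
    (∀ k ≤ n, f k ∈ P.X0 ∩ P.X1) ∧
    s = ∑ j ∈ Finset.range n, P.PFun θ q (f j) (f (j + 1)) }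

end CompatiblePair

/-- Hölder's inequality for `[0,∞]`-valued families, for all conjugate exponents in `[1,∞]`. -/
theorem ENNReal.tsum_mul_le_of_conjugate {ι : Type*} (p q : ℝ≥0∞) (hpq : 1 / p + 1 / q = 1)
    (f g : ι → ℝ≥0∞) :
    ∑' i, f i * g i ≤
      (if p = ∞ then ⨆ i, f i else (∑' i, f i ^ p.toReal) ^ (1 / p.toReal)) *
        (if q = ∞ then ⨆ i, g i else (∑' i, g i ^ q.toReal) ^ (1 / q.toReal)) := by
  by_cases hp : p = ∞
  · have hq : q = 1 := by simpa [hp] using hpq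
    simp only [hp, hq, if_true, ENNReal.one_ne_top, if_false, ENNReal.toReal_one,
      ENNReal.rpow_one, div_one]
    rw [← ENNReal.tsum_mul_left]
    exact ENNReal.tsum_le_tsum fun i => by gcongr; exact le_iSup f i
  by_cases hq : q = ∞
  · have hp1 : p = 1 := by simpa [hq] using hpq
    simp only [hp1, hq, if_true, ENNReal.one_ne_top, if_false, ENNReal.toReal_one,
      ENNReal.rpow_one, div_one]
    rw [← ENNReal.tsum_mul_right]
    exact ENNReal.tsum_le_tsum fun i => by gcongr; exact le_iSup g i
  rw [if_neg hp, if_neg hq]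
  have : ENNReal.HolderConjugate p q :=
    ENNReal.holderConjugate_iff.mpr (by simpa only [one_div] using hpq)
  have hconj : p.toReal.HolderConjugate q.toReal := ENNReal.HolderConjugate.toReal_of_ne_top hp hq
  rw [ENNReal.tsum_eq_iSup_sum]
  refine iSup_le fun s => (ENNReal.inner_le_Lp_mul_Lq s f g hconj).trans ?_
  have hp0 : 0 ≤ 1 / p.toReal := one_div_nonneg.mpr hconj.nonneg
  have hq0 : 0 ≤ 1 / q.toReal := one_div_nonneg.mpr hconj.symm.nonneg
  gcongr <;> exact ENNReal.sum_le_tsum s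

/-- The total length of a bi-infinite sequence bounds the distance between its two limits. -/
theorem edist_le_tsum_int_of_tendsto {X : Type*} [PseudoEMetricSpace X] (S : ℤ → X) {x y : X}
    (hx : Filter.Tendsto (fun n : ℕ => S n) Filter.atTop (nhds x))
    (hy : Filter.Tendsto (fun n : ℕ => S (-n)) Filter.atTop (nhds y)) :
    edist x y ≤ ∑' k : ℤ, edist (S k) (S (k + 1)) := by
  refine le_of_tendsto' (hx.edist hy) fun n => ?_
  rw [edist_comm]
  have hchain := edist_le_range_sum_edist (fun i : ℕ => S (-n + i)) (2 * n)
  have hend : (-(n : ℤ) + ((2 * n : ℕ) : ℤ)) = n := by push_cast; ring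
  simp only [hend, Nat.cast_zero, add_zero] at hchain
  refine hchain.trans ((ENNReal.sum_le_tsum _).trans ?_)
  have hinj : Function.Injective fun i : ℕ => (-(n : ℤ) + i) := fun a b h => by simpa using h
  refine le_trans (le_of_eq ?_) (ENNReal.tsum_comp_le_tsum_of_injective hinj _)
  simp [add_assoc]

namespace CompatiblePair

variable {X : Type*} [MetricSpace X] {P : CompatiblePair X}

/-- The pair with `X₀ = X₁ = X` and `d₀ = d₁ = d_X`. -/
structure IsTrivial (P : CompatiblePair X) : Prop where
  X0_eq : P.X0 = Set.univ
  X1_eq : P.X1 = Set.univ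
  d0_eq : P.d0 = fun x y => dist x y
  d1_eq : P.d1 = fun x y => dist x y

namespace IsTrivial

theorem KM_one (hP : P.IsTrivial) (x y : X) : P.KM 1 x y = dist x y := by
  have hh : ∀ a b, P.hFun 1 a b = dist a b := fun a b => by
    simp [hFun, hP.X0_eq, hP.X1_eq, hP.d0_eq, hP.d1_eq]
  have hlower : ∀ s ∈ { s : ℝ | ∃ n f, P.IsAdmissibleChain x y n f ∧
      s = ∑ k ∈ Finset.range n, P.hFun 1 (f k) (f (k + 1)) }, dist x y ≤ s := by
    rintro s ⟨n, f, ⟨rfl, rfl, -, -⟩, rfl⟩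
    simpa only [hh] using dist_le_range_sum_dist f n
  have hmem : dist x y ∈ { s : ℝ | ∃ n f, P.IsAdmissibleChain x y n f ∧
      s = ∑ k ∈ Finset.range n, P.hFun 1 (f k) (f (k + 1)) } :=
    ⟨1, fun k => if k = 0 then x else y, by
      simp [IsAdmissibleChain, hP.X0_eq, hP.X1_eq], by simp [hh]⟩
  exact IsLeast.csInf_eq ⟨hmem, hlower⟩

theorem tendsto_of_isApproxSeq (hP : P.IsTrivial) {x : X} {u : ℕ → X} (hu : P.IsApproxSeq x u) :
    Filter.Tendsto u Filter.atTop (nhds x) := by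
  rw [tendsto_iff_dist_tendsto_zero]
  simpa only [hP.KM_one] using hu.2.2

theorem isApproxSeq_of_tendsto (hP : P.IsTrivial) {x : X} {u : ℕ → X}
    (hu : Filter.Tendsto u Filter.atTop (nhds x)) : P.IsApproxSeq x u := by
  refine ⟨fun n => by simp [hP.X0_eq, hP.X1_eq], fun ε hε => ?_, ?_⟩
  · simpa [JM, hP.d0_eq, hP.d1_eq] using Metric.cauchySeq_iff.mp hu.cauchySeq ε hε
  · simpa only [hP.KM_one] using tendsto_iff_dist_tendsto_zero.mp hu

/-- Linking `y` to `x` by a single jump at `k = 0`. -/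
theorem pFunE_le_edist (hP : P.IsTrivial) {θ : ℝ} {q : ℝ≥0∞} (hq : 1 ≤ q) (x y : X) :
    P.pFunE θ q x y ≤ edist x y := by
  have hu : P.IsApproxSeq x (fun n => if n = 0 then y else x) :=
    hP.isApproxSeq_of_tendsto <| tendsto_const_nhds.congr' <| by
      filter_upwards [Filter.eventually_gt_atTop 0] with n hn
      simp [hn.ne']
  have hv : P.IsApproxSeq y (fun _ => y) := hP.isApproxSeq_of_tendsto tendsto_const_nhds
  refine (iInf₂_le_of_le _ _ (iInf₂_le hu hv)).trans ?_
  have hterm : ∀ k : ℤ, ENNReal.ofReal ((2 : ℝ) ^ (-(k : ℝ) * θ) *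
      |P.JM ((2 : ℝ) ^ k) (linkSeq (fun n => if n = 0 then y else x) (fun _ => y) k)
        (linkSeq (fun n => if n = 0 then y else x) (fun _ => y) (k + 1))|) =
      if k = 0 then edist x y else 0 := by
    intro k
    rcases lt_trichotomy k 0 with hk | rfl | hk
    · have h1 : ¬ 0 ≤ k := by omega
      have h2 : 0 ≤ k + 1 → (k + 1).toNat = 0 := by omega
      simp +contextual [linkSeq, h1, h2, hk.ne, JM, hP.d0_eq, hP.d1_eq]
    · simp [linkSeq, JM, hP.d0_eq, hP.d1_eq, edist_dist, dist_comm]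
    · have h1 : ¬ k ≤ 0 := by omega
      have h2 : ¬ k + 1 ≤ 0 := by omega
      have h3 : 0 ≤ k + 1 := by omega
      simp [linkSeq, h1, h2, h3, hk.le, hk.ne', JM, hP.d0_eq, hP.d1_eq]
  unfold GammaE
  simp only [hterm]
  split_ifs with hqt
  · exact iSup_le fun k => by split_ifs <;> simp
  · have hq0 : 0 < q.toReal := ENNReal.toReal_pos (zero_lt_one.trans_le hq).ne' hqt
    rw [tsum_eq_single 0 (fun k hk => by simp [hk, hq0])]
    simp [← ENNReal.rpow_mul, hq0.ne']

theorem edist_le_ofReal_JM_mul (hP : P.IsTrivial) (θ : ℝ) (k : ℤ) (a b : X) :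
    edist a b ≤ ENNReal.ofReal ((2 : ℝ) ^ ((k : ℝ) * θ) * min 1 ((2 : ℝ) ^ (-(k : ℝ)))) *
      ENNReal.ofReal ((2 : ℝ) ^ (-(k : ℝ) * θ) * |P.JM ((2 : ℝ) ^ k) a b|) := by
  rw [← ENNReal.ofReal_mul (by positivity), edist_dist]
  refine ENNReal.ofReal_le_ofReal ?_
  have hweight : (2 : ℝ) ^ ((k : ℝ) * θ) * (2 : ℝ) ^ (-(k : ℝ) * θ) = 1 := by
    rw [← Real.rpow_add two_pos]; simp
  have hpow : (2 : ℝ) ^ (-(k : ℝ)) * (2 : ℝ) ^ k = 1 := by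
    rw [← Real.rpow_intCast, ← Real.rpow_add two_pos]; simp
  have hd : dist a b ≤ |P.JM ((2 : ℝ) ^ k) a b| := by
    simpa [JM, hP.d0_eq] using (le_max_left _ _).trans (le_abs_self (P.JM ((2 : ℝ) ^ k) a b))
  have hd' : (2 : ℝ) ^ k * dist a b ≤ |P.JM ((2 : ℝ) ^ k) a b| := by
    simpa [JM, hP.d1_eq] using (le_max_right _ _).trans (le_abs_self (P.JM ((2 : ℝ) ^ k) a b))
  calc dist a b ≤ min 1 ((2 : ℝ) ^ (-(k : ℝ))) * |P.JM ((2 : ℝ) ^ k) a b| := by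
        rcases min_choice 1 ((2 : ℝ) ^ (-(k : ℝ))) with h | h <;> rw [h]
        · simpa using hd
        · calc dist a b = (2 : ℝ) ^ (-(k : ℝ)) * ((2 : ℝ) ^ k * dist a b) := by
                rw [← mul_assoc, hpow, one_mul]
            _ ≤ _ := by gcongr
    _ = ((2 : ℝ) ^ ((k : ℝ) * θ) * (2 : ℝ) ^ (-(k : ℝ) * θ)) *
        (min 1 ((2 : ℝ) ^ (-(k : ℝ))) * |P.JM ((2 : ℝ) ^ k) a b|) := by rw [hweight, one_mul]
    _ = _ := by ring

theorem pFun_le_dist (hP : P.IsTrivial) {θ : ℝ} {q : ℝ≥0∞} (hq : 1 ≤ q) (x y : X) :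
    P.pFun θ q x y ≤ dist x y := by
  rw [dist_edist]
  exact ENNReal.toReal_mono (edist_ne_top x y) (hP.pFunE_le_edist hq x y)

theorem dist_le_MConst'_mul_pFun (hP : P.IsTrivial) {θ : ℝ} {q p : ℝ≥0∞} (hq : 1 ≤ q)
    (hpq : 1 / p + 1 / q = 1) (hM : MConst' θ p ≠ 0) (x y : X) :
    dist x y ≤ MConst' θ p * P.pFun θ q x y := by
  unfold MConst' at hM ⊢
  have hMtop := (ENNReal.toReal_ne_zero.mp hM).2
  have hM0 := (ENNReal.toReal_ne_zero.mp hM).1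
  rw [dist_edist, pFun, ← ENNReal.toReal_mul]
  refine ENNReal.toReal_mono (ENNReal.mul_ne_top hMtop
    (ne_top_of_le_ne_top (edist_ne_top x y) (hP.pFunE_le_edist hq x y))) ?_
  rw [← ENNReal.div_le_iff' hM0 hMtop]
  refine le_iInf₂ fun u v => le_iInf₂ fun hu hv => ?_
  rw [ENNReal.div_le_iff' hM0 hMtop]
  have hx : Filter.Tendsto (fun n : ℕ => linkSeq u v n) Filter.atTop (nhds x) := by
    simpa [linkSeq] using hP.tendsto_of_isApproxSeq hu
  have hy : Filter.Tendsto (fun n : ℕ => linkSeq u v (-n)) Filter.atTop (nhds y) := by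
    refine (hP.tendsto_of_isApproxSeq hv).congr' ?_
    filter_upwards [Filter.eventually_gt_atTop 0] with n hn
    simp [linkSeq, hn.ne']
  refine (edist_le_tsum_int_of_tendsto _ hx hy).trans ?_
  refine (ENNReal.tsum_le_tsum fun k => hP.edist_le_ofReal_JM_mul θ k _ _).trans ?_
  exact ENNReal.tsum_mul_le_of_conjugate p q hpq _ _

end IsTrivial

end CompatiblePair

/-- when `X₀ = X₁ = X` and `d₀ = d₁ = d_X`, the metric `δ_{θ,q}` is
equivalent to `d_X`: `(1/M'_{θ,q}) d_X ≤ δ_{θ,q} ≤ d_X`. -/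
theorem delta_equiv_dist_of_trivial_pair {X : Type*} [MetricSpace X]
    (P : CompatiblePair X)
    (h0 : P.X0 = Set.univ) (h1 : P.X1 = Set.univ)
    (hd0 : P.d0 = fun x y => dist x y) (hd1 : P.d1 = fun x y => dist x y)
    (θ : ℝ) (hθ : θ ∈ Set.Ioo (0 : ℝ) 1) (q p : ℝ≥0∞) (hq : 1 ≤ q)
    (hpq : 1 / p + 1 / q = 1) :
    ∀ x y : X,
      (1 / MConst' θ p) * dist x y ≤ P.delta θ q x y ∧
        P.delta θ q x y ≤ dist x y := by
  intro x y
  have hP : P.IsTrivial := ⟨h0, h1, hd0, hd1⟩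
  have hPnonneg : ∀ a b, 0 ≤ P.PFun θ q a b := fun a b =>
    div_nonneg (add_nonneg ENNReal.toReal_nonneg ENNReal.toReal_nonneg) zero_le_two
  have hPle : ∀ a b, P.PFun θ q a b ≤ dist a b := fun a b => by
    have hab := hP.pFun_le_dist (θ := θ) hq a b
    have hba := hP.pFun_le_dist (θ := θ) hq b a
    rw [dist_comm] at hba
    unfold CompatiblePair.PFun
    linarith
  have hMP : ∀ a b, 1 / MConst' θ p * dist a b ≤ P.PFun θ q a b := fun a b => by
    by_cases hM : MConst' θ p = 0
    · simpa [hM] using hPnonneg a b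
    have hMpos : 0 < MConst' θ p := lt_of_le_of_ne ENNReal.toReal_nonneg (Ne.symm hM)
    have hab := hP.dist_le_MConst'_mul_pFun hq hpq hM a b
    have hba := hP.dist_le_MConst'_mul_pFun hq hpq hM b a
    rw [dist_comm] at hba
    rw [one_div, inv_mul_le_iff₀ hMpos]
    unfold CompatiblePair.PFun
    linarith
  have hMnonneg : 0 ≤ 1 / MConst' θ p := one_div_nonneg.mpr ENNReal.toReal_nonneg
  have hjump : P.PFun θ q x y ∈ { s : ℝ | ∃ (n : ℕ) (f : ℕ → X), f 0 = x ∧ f n = y ∧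
      (∀ k ≤ n, f k ∈ P.X0 ∩ P.X1) ∧
      s = ∑ j ∈ Finset.range n, P.PFun θ q (f j) (f (j + 1)) } :=
    ⟨1, fun k => if k = 0 then x else y, by simp, by simp, by simp [h0, h1], by simp⟩
  constructor
  · refine le_csInf ⟨_, hjump⟩ ?_
    rintro s ⟨n, f, rfl, rfl, -, rfl⟩
    calc 1 / MConst' θ p * dist (f 0) (f n)
        ≤ 1 / MConst' θ p * ∑ j ∈ Finset.range n, dist (f j) (f (j + 1)) := by
          gcongr; exact dist_le_range_sum_dist f n
      _ ≤ _ := by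
          rw [Finset.mul_sum]
          exact Finset.sum_le_sum fun j _ => hMP _ _
  · refine (csInf_le ⟨0, ?_⟩ hjump).trans (hPle x y)
    rintro s ⟨n, f, -, -, -, rfl⟩
    exact Finset.sum_nonneg fun j _ => hPnonneg _ _
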